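/- For every τ ∈ ℍ, the Appell–Lerch sum F(τ) := −(1/θ₄(τ)) ∑_{n∈ℤ} (−1)ⁿ q^{n²/2 − 1/8}/(1 − q^{n−1/2}) admits the alternative representation F(τ) = θ₂(τ)⁴/(4η(τ)³) − (1/θ₃(τ)) ∑_{n∈ℤ} q^{n²/2 − 1/8}/(1 + q^{n−1/2}). Equivalently, 24 F(τ) = H(τ) + 2(θ₂(τ)⁴ + θ₃(τ)⁴)/η(τ)³, where H(τ) := 2(θ₂(τ)⁴ − θ₄(τ)⁴)/η(τ)³ − (24/θ₃(τ)) ∑_{n∈ℤ} q^{n²/2 − 1/8}/(1 + q^{n−1/2}) is the Mathieu moonshine q-series H^{(2)}. -/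

import Mathlib

open Complex

noncomputable section

/-- `e^{2πiτs}`, i.e. `q^s` for `q = e^{2πiτ}`. -/
def qp (τ s : ℂ) : ℂ := Complex.exp (2 * (Real.pi : ℂ) * Complex.I * τ * s)

/-- Jacobi theta constant `θ₂(τ) = ∑_{r∈ℤ+1/2} q^{r²/2}`. -/
def theta2 (τ : ℂ) : ℂ := ∑' n : ℤ, qp τ (((n : ℂ) + 1 / 2) ^ 2 / 2)

/-- Jacobi theta constant `θ₃(τ) = ∑_{n∈ℤ} q^{n²/2}`. -/
def theta3 (τ : ℂ) : ℂ := ∑' n : ℤ, qp τ ((n : ℂ) ^ 2 / 2)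

/-- Jacobi theta constant `θ₄(τ) = ∑_{n∈ℤ} (−1)ⁿ q^{n²/2}`. -/
def theta4 (τ : ℂ) : ℂ := ∑' n : ℤ, (-1 : ℂ) ^ n * qp τ ((n : ℂ) ^ 2 / 2)

/-- Dedekind eta function `η(τ) = q^{1/24} ∏_{n≥1}(1 − qⁿ)`. -/
def etaDedekind (τ : ℂ) : ℂ :=
  Complex.exp ((Real.pi : ℂ) * Complex.I * τ / 12) * ∏' n : ℕ, (1 - qp τ ((n : ℂ) + 1))

/-- The Appell–Lerch sum `F(τ) = −(1/θ₄(τ)) ∑_{n∈ℤ} (−1)ⁿ q^{n²/2−1/8}/(1 − q^{n−1/2})`. -/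
def F0 (τ : ℂ) : ℂ :=
  -(1 / theta4 τ) *
    ∑' n : ℤ, (-1 : ℂ) ^ n * qp τ ((n : ℂ) ^ 2 / 2 - 1 / 8) / (1 - qp τ ((n : ℂ) - 1 / 2))

/-- The Mathieu moonshine q-series
`H(τ) = 2(θ₂⁴ − θ₄⁴)/η³ − (24/θ₃) ∑_{n∈ℤ} q^{n²/2−1/8}/(1 + q^{n−1/2})`. -/
def H0 (τ : ℂ) : ℂ :=
  2 * (theta2 τ ^ 4 - theta4 τ ^ 4) / etaDedekind τ ^ 3 -
    (24 / theta3 τ) * ∑' n : ℤ, qp τ ((n : ℂ) ^ 2 / 2 - 1 / 8) / (1 + qp τ ((n : ℂ) - 1 / 2))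



open Filter Topology

lemma gs (ρ R : ℝ) (h0 : 0 ≤ ρ) (h1 : ρ < 1) (hR : 0 ≤ R) :
    Summable fun n : ℤ => ρ ^ (n.natAbs ^ 2) * R ^ n.natAbs := by
  have key : Summable fun n : ℕ => ρ ^ (n ^ 2) * R ^ n := by
    have hev : ∀ᶠ n : ℕ in atTop, ρ ^ n * R < 1 / 2 := by
      have : Tendsto (fun n : ℕ => ρ ^ n * R) atTop (𝓝 (0 * R)) :=
        (tendsto_pow_atTop_nhds_zero_of_lt_one h0 h1).mul_const R
      rw [zero_mul] at this
      exact this.eventually (gt_mem_nhds (by norm_num))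
    have hg : Summable fun n : ℕ => (1 / 2 : ℝ) ^ n :=
      summable_geometric_of_lt_one (by norm_num) (by norm_num)
    refine hg.of_norm_bounded_eventually_nat ?_
    filter_upwards [hev] with n hn
    rw [Real.norm_of_nonneg (by positivity), sq, pow_mul, ← mul_pow]
    exact pow_le_pow_left₀ (by positivity) hn.le n
  apply Summable.of_nat_of_neg <;> simpa using key

lemma zb (y : ℂ) (R : ℝ) (h1 : ‖y‖ ≤ R) (h2 : ‖y⁻¹‖ ≤ R) (m : ℤ) :
    ‖y ^ m‖ ≤ R ^ m.natAbs := by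
  rcases Int.natAbs_eq m with h | h
  · rw [h, zpow_natCast, norm_pow, Int.natAbs_natCast]
    exact pow_le_pow_left₀ (norm_nonneg _) h1 _
  · rw [h, zpow_neg, ← inv_zpow, zpow_natCast, norm_pow, Int.natAbs_neg, Int.natAbs_natCast]
    exact pow_le_pow_left₀ (norm_nonneg _) h2 _

lemma zsq (p : ℂ) (m : ℤ) : ‖p ^ (m ^ 2)‖ = ‖p‖ ^ (m.natAbs ^ 2) := by
  have : m ^ 2 = ((m.natAbs ^ 2 : ℕ) : ℤ) := by simp
  rw [this, zpow_natCast, norm_pow]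

lemma gsum (p y : ℂ) (hp : ‖p‖ < 1) :
    Summable fun m : ℤ => ‖p ^ (m ^ 2) * y ^ m‖ := by
  refine Summable.of_nonneg_of_le (fun _ => norm_nonneg _) (fun m => ?_)
    (gs ‖p‖ (max ‖y‖ ‖y⁻¹‖) (norm_nonneg _) hp (le_max_of_le_left (norm_nonneg _)))
  rw [norm_mul, zsq]
  gcongr
  exact zb y _ (le_max_left _ _) (le_max_right _ _) m

def jf (p y : ℂ) : ℂ := ∑' m : ℤ, (-1) ^ m * p ^ (m * (m - 1)) * y ^ m

lemma jterm (p y : ℂ) (hp0 : p ≠ 0) (m : ℤ) :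
    (-1) ^ m * p ^ (m * (m - 1)) * y ^ m = p ^ (m ^ 2) * (-y / p) ^ m := by
  have : (-y / p) ^ m = (-1) ^ m * y ^ m * (p ^ m)⁻¹ := by
    rw [div_eq_mul_inv, ← neg_one_mul, mul_zpow, mul_zpow, inv_zpow]
  rw [this, show m * (m - 1) = m ^ 2 - m by ring, zpow_sub₀ hp0]
  ring

lemma jsum (p y : ℂ) (hp0 : p ≠ 0) (hp : ‖p‖ < 1) :
    Summable fun m : ℤ => ‖(-1) ^ m * p ^ (m * (m - 1)) * y ^ m‖ := by
  simp_rw [jterm p y hp0]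
  exact gsum p _ hp

def Gf (p y : ℂ) : ℂ := ∏' k : ℕ, (1 - y * p ^ (2 * (k + 1)))

lemma geo2 (p : ℂ) (hp : ‖p‖ < 1) : Summable fun k : ℕ => ‖p‖ ^ (2 * (k + 1)) := by
  have : ‖p‖ ^ 2 < 1 := by
    rw [sq]; nlinarith [norm_nonneg p]
  simp_rw [pow_mul]
  exact (summable_nat_add_iff 1).mpr (summable_geometric_of_lt_one (by positivity) this)

lemma Gmul (p y : ℂ) (hp : ‖p‖ < 1) : Multipliable fun k : ℕ => (1 - y * p ^ (2 * (k + 1))) := by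
  have := multipliable_one_add_of_summable (f := fun k : ℕ => - (y * p ^ (2 * (k + 1)))) (by
    simpa using (geo2 p hp).mul_left ‖y‖)
  simpa [sub_eq_add_neg] using this

lemma Gtend (p y : ℂ) (hp : ‖p‖ < 1) :
    Tendsto (fun N : ℕ => ∏ k ∈ Finset.range N, (1 - y * p ^ (2 * (k + 1)))) atTop (𝓝 (Gf p y)) :=
  (Gmul p y hp).hasProd.tendsto_prod_nat

lemma one_sub_ne (p : ℂ) (hp : ‖p‖ < 1) (k : ℕ) (hk : k ≠ 0) : 1 - p ^ k ≠ 0 := by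
  intro h
  have : ‖p ^ k‖ = 1 := by rw [← sub_eq_zero.mp h]; simp
  rw [norm_pow] at this
  exact absurd this (pow_lt_one₀ (norm_nonneg _) hp hk).ne

lemma G1_ne (p : ℂ) (hp : ‖p‖ < 1) : Gf p 1 ≠ 0 := by
  have := tprod_one_add_ne_zero_of_summable (f := fun k : ℕ => - (p ^ (2 * (k + 1)))) (by
    intro k
    simpa [sub_eq_add_neg] using one_sub_ne p hp (2 * (k + 1)) (by omega)) (by
    simpa using geo2 p hp)
  simpa [Gf, sub_eq_add_neg] using this

/-- finite q-Pochhammer -/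
def qq (p : ℂ) (N : ℕ) : ℂ := ∏ k ∈ Finset.range N, (1 - p ^ (2 * (k + 1)))

lemma qq_ne (p : ℂ) (hp : ‖p‖ < 1) (N : ℕ) : qq p N ≠ 0 :=
  Finset.prod_ne_zero_iff.mpr fun k _ => one_sub_ne p hp _ (by omega)

def ee (p : ℂ) (n : ℤ) : ℂ := if n < 0 then 0 else (qq p n.toNat)⁻¹

lemma ee_rec (p : ℂ) (hp : ‖p‖ < 1) (n : ℤ) : ee p (n - 1) = (1 - p ^ (2 * n)) * ee p n := by
  rcases lt_trichotomy n 0 with h | h | h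
  · simp [ee, h, show n - 1 < 0 by omega]
  · subst h; simp [ee]
  · obtain ⟨k, rfl⟩ : ∃ k : ℕ, n = k + 1 := ⟨(n - 1).toNat, by omega⟩
    have h1 : ¬ ((k : ℤ) + 1 < 0) := by omega
    have h3 : ((k : ℤ) + 1).toNat = k + 1 := by omega
    have h4 : p ^ (2 * ((k : ℤ) + 1)) = p ^ (2 * (k + 1)) := by
      rw [← zpow_natCast]; congr 1
    have := one_sub_ne p hp (2 * (k + 1)) (by omega)
    have := qq_ne p hp k
    simp only [ee, add_sub_cancel_right, h1, if_false, h3, h4, Int.toNat_natCast]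
    rw [if_neg (by omega), show qq p (k + 1) = qq p k * (1 - p ^ (2 * (k + 1))) from
      Finset.prod_range_succ _ _]
    field_simp

lemma ee_tend (p : ℂ) (hp : ‖p‖ < 1) (m : ℤ) :
    Tendsto (fun N : ℕ => ee p (N + m)) atTop (𝓝 (Gf p 1)⁻¹) := by
  have h := (Gtend p 1 hp).inv₀ (G1_ne p hp)
  simp only [one_mul] at h
  have h2 : Tendsto (fun N : ℕ => ((N : ℤ) + m).toNat) atTop atTop := by
    rw [tendsto_atTop]
    intro b
    filter_upwards [eventually_ge_atTop (b + m.natAbs)] with N hN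
    omega
  refine (h.comp h2).congr' ?_
  filter_upwards [eventually_ge_atTop m.natAbs] with N hN
  simp only [ee, Function.comp, qq]
  rw [if_neg (by omega)]

lemma qq_tend (p : ℂ) (hp : ‖p‖ < 1) : Tendsto (qq p) atTop (𝓝 (Gf p 1)) := by
  have := Gtend p 1 hp
  simp only [one_mul] at this
  exact this

lemma ee_bdd (p : ℂ) (hp : ‖p‖ < 1) : ∃ K, ∀ n, ‖ee p n‖ ≤ K := by
  have h := ((qq_tend p hp).inv₀ (G1_ne p hp)).norm.bddAbove_range
  obtain ⟨K, hK⟩ := h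
  refine ⟨max K 0, fun n => ?_⟩
  unfold ee
  split_ifs
  · simp
  · exact le_max_of_le_left (hK ⟨n.toNat, rfl⟩)

def cc (p : ℂ) (N : ℕ) (m : ℤ) : ℂ := qq p (2 * N) * ee p (N + m) * ee p (N - m)

lemma cc_rec (p : ℂ) (hp0 : p ≠ 0) (hp : ‖p‖ < 1) (N : ℕ) (m : ℤ) :
    cc p (N + 1) m = (1 + p ^ (4 * N + 2)) * cc p N m +
      p ^ (2 * ((N : ℤ) - m + 1)) * cc p N (m - 1) +
      p ^ (2 * ((N : ℤ) + m + 1)) * cc p N (m + 1) := by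
  have hq : qq p (2 * (N + 1)) = qq p (2 * N) * (1 - p ^ (4 * N + 2)) * (1 - p ^ (4 * N + 4)) := by
    rw [show 2 * (N + 1) = 2 * N + 1 + 1 by ring, qq, Finset.prod_range_succ,
      Finset.prod_range_succ, qq]
    ring_nf
  have e1 := ee_rec p hp (N + m + 1)
  have e2 := ee_rec p hp (N + m)
  have e3 := ee_rec p hp (N - m + 1)
  have e4 := ee_rec p hp (N - m)
  have hA : p ^ (2 * ((N : ℤ) + m)) = p ^ (2 * ((N : ℤ) + m + 1)) / p ^ 2 := by
    rw [show 2 * ((N : ℤ) + m) = 2 * ((N : ℤ) + m + 1) - 2 by ring, zpow_sub₀ hp0]; norm_cast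
  have hD : p ^ (2 * ((N : ℤ) - m)) = p ^ (2 * ((N : ℤ) - m + 1)) / p ^ 2 := by
    rw [show 2 * ((N : ℤ) - m) = 2 * ((N : ℤ) - m + 1) - 2 by ring, zpow_sub₀ hp0]; norm_cast
  have hAD : p ^ (4 * N + 4) = p ^ (2 * ((N : ℤ) + m + 1)) * p ^ (2 * ((N : ℤ) - m + 1)) := by
    rw [← zpow_add₀ hp0, ← zpow_natCast]; congr 1; push_cast; ring
  have hAD2 : p ^ (4 * N + 2) = p ^ (4 * N + 4) / p ^ 2 := by
    field_simp
    ring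
  rw [hAD] at hAD2
  rw [hA] at e2
  rw [hD] at e4
  rw [show (N : ℤ) + m + 1 - 1 = N + m by ring] at e1
  rw [show (N : ℤ) - m + 1 - 1 = N - m by ring] at e3
  simp only [cc, hq, hAD, hAD2]
  push_cast
  rw [show (N : ℤ) + 1 + m = N + m + 1 by ring, show (N : ℤ) + 1 - m = N - m + 1 by ring,
    show (N : ℤ) + (m - 1) = N + m - 1 by ring, show (N : ℤ) - (m - 1) = N - m + 1 by ring,
    show (N : ℤ) + (m + 1) = N + m + 1 by ring, show (N : ℤ) - (m + 1) = N - m - 1 by ring,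
    e2, e4, e1, e3]
  generalize p ^ (2 * ((N : ℤ) + m + 1)) = A
  generalize p ^ (2 * ((N : ℤ) - m + 1)) = D
  generalize ee p (N + m + 1) = X
  generalize ee p (N - m + 1) = Y
  field_simp
  ring

lemma finite_jtp (p y : ℂ) (hp0 : p ≠ 0) (hp : ‖p‖ < 1) (hy : y ≠ 0) (N : ℕ) :
    HasSum (fun m : ℤ => (-1) ^ m * p ^ (m * (m - 1)) * y ^ m * cc p N m)
      (∏ k ∈ Finset.range N, ((1 - y * p ^ (2 * k)) * (1 - y⁻¹ * p ^ (2 * (k + 1))))) := by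
  induction N with
  | zero =>
    have := hasSum_ite_eq (0 : ℤ) (1 : ℂ)
    simp only [Finset.range_zero, Finset.prod_empty]
    convert this using 2 with m
    split_ifs with h
    · subst h; simp [cc, ee, qq]
    · rcases lt_or_gt_of_ne h with h | h
      · simp [cc, ee, h]
      · simp [cc, ee, h]
  | succ N ih =>
    rw [Finset.prod_range_succ]
    have s1 := (Equiv.subRight (1 : ℤ)).hasSum_iff.mpr ih
    have s2 := (Equiv.addRight (1 : ℤ)).hasSum_iff.mpr ih
    have := ((ih.mul_left (1 + p ^ (4 * N + 2))).add (s1.mul_left (- (y * p ^ (2 * N))))).add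
      (s2.mul_left (-(y⁻¹ * p ^ (2 * (N + 1)))))
    convert this using 1
    · rfl
    · funext m
      rw [cc_rec p hp0 hp]
      simp only [Function.comp, Equiv.subRight_apply, Equiv.coe_addRight]
      have a1 : ((-1 : ℂ)) ^ (m - 1) = - (-1) ^ m := by
        rw [zpow_sub₀ (by norm_num)]; simp [div_neg]
      have a2 : ((-1 : ℂ)) ^ (m + 1) = - (-1) ^ m := by
        rw [zpow_add₀ (by norm_num)]; simp
      have b1 : p ^ ((m - 1) * (m - 1 - 1)) * p ^ (2 * N) =
          p ^ (m * (m - 1)) * p ^ (2 * ((N : ℤ) - m + 1)) := by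
        rw [← zpow_natCast, ← zpow_add₀ hp0, ← zpow_add₀ hp0]; congr 1; push_cast; ring
      have b2 : p ^ ((m + 1) * (m + 1 - 1)) * p ^ (2 * (N + 1)) =
          p ^ (m * (m - 1)) * p ^ (2 * ((N : ℤ) + m + 1)) := by
        rw [← zpow_natCast, ← zpow_add₀ hp0, ← zpow_add₀ hp0]; congr 1; push_cast; ring
      rw [a1, a2, zpow_sub₀ hy, zpow_add₀ hy, zpow_one]
      have c1 : -(y * p ^ (2 * N)) * (-(-1) ^ m * p ^ ((m - 1) * (m - 1 - 1)) * (y ^ m / y) *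
          cc p N (m - 1)) = (-1) ^ m * y ^ m * cc p N (m - 1) *
            (p ^ ((m - 1) * (m - 1 - 1)) * p ^ (2 * N)) := by field_simp
      have c2 : -(y⁻¹ * p ^ (2 * (N + 1))) * (-(-1) ^ m * p ^ ((m + 1) * (m + 1 - 1)) *
          (y ^ m * y) * cc p N (m + 1)) = (-1) ^ m * y ^ m * cc p N (m + 1) *
            (p ^ ((m + 1) * (m + 1 - 1)) * p ^ (2 * (N + 1))) := by field_simp
      rw [c1, c2, b1, b2]
      ring
    · have : y * y⁻¹ = 1 := mul_inv_cancel₀ hy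
      linear_combination (∏ k ∈ Finset.range N, ((1 - y * p ^ (2 * k)) * (1 - y⁻¹ * p ^ (2 * (k + 1))))) * p ^ (2 * N) * p ^ (2 * (N + 1)) * this

lemma jtp (p y : ℂ) (hp0 : p ≠ 0) (hp : ‖p‖ < 1) (hy : y ≠ 0) :
    jf p y = Gf p 1 * ((1 - y) * Gf p y * Gf p y⁻¹) := by
  obtain ⟨K, hK⟩ := ee_bdd p hp
  obtain ⟨L, hL⟩ := (qq_tend p hp).norm.bddAbove_range
  have hG := G1_ne p hp
  have hK0 : 0 ≤ K := (norm_nonneg _).trans (hK 0)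
  have hL0 : 0 ≤ L := (norm_nonneg _).trans (hL ⟨0, rfl⟩)
  have t1 : Tendsto (fun N : ℕ => ∑' m : ℤ, (-1) ^ m * p ^ (m * (m - 1)) * y ^ m * cc p N m)
      atTop (𝓝 (∑' m : ℤ, (-1) ^ m * p ^ (m * (m - 1)) * y ^ m * (Gf p 1)⁻¹)) := by
    refine tendsto_tsum_of_dominated_convergence
      (bound := fun m : ℤ => ‖(-1) ^ m * p ^ (m * (m - 1)) * y ^ m‖ * (L * K * K))
      ((jsum p y hp0 hp).mul_right _) (fun m => ?_) (Eventually.of_forall fun N m => ?_)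
    · refine Tendsto.const_mul _ ?_
      have h2 : Tendsto (fun N : ℕ => qq p (2 * N)) atTop (𝓝 (Gf p 1)) :=
        (qq_tend p hp).comp (tendsto_id.const_mul_atTop' (by norm_num))
      have := (h2.mul (ee_tend p hp m)).mul (ee_tend p hp (-m))
      simpa [cc, hG, sub_eq_add_neg] using this
    · rw [norm_mul]
      gcongr
      rw [cc, norm_mul, norm_mul]
      gcongr
      · exact hL ⟨2 * N, rfl⟩
      · exact hK _
      · exact hK _
  have t2 : Tendsto (fun N : ℕ => ∏ k ∈ Finset.range N,
      ((1 - y * p ^ (2 * k)) * (1 - y⁻¹ * p ^ (2 * (k + 1))))) atTop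
      (𝓝 (((1 - y) * Gf p y) * Gf p y⁻¹)) := by
    simp_rw [Finset.prod_mul_distrib]
    refine Tendsto.mul ?_ (Gtend p _ hp)
    rw [← tendsto_add_atTop_iff_nat 1]
    simp_rw [Finset.prod_range_succ']
    have := (Gtend p y hp).mul_const (1 - y)
    simpa [mul_comm] using this
  simp_rw [(finite_jtp p y hp0 hp hy _).tsum_eq] at t1
  have := tendsto_nhds_unique t1 t2
  rw [tsum_mul_right, ← jf] at this
  rw [← this]
  field_simp

def dt (p : ℂ) (n : ℕ) : ℂ := (-1) ^ n * p ^ (n * (n + 1))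

def dN (p : ℂ) (n : ℕ) : ℂ := ∑' i : ℕ, dt p (n + i)

def dk (p : ℂ) (k : ℤ) : ℂ := dN p k.natAbs

lemma dt_bound (p : ℂ) (hp : ‖p‖ < 1) (n i : ℕ) : ‖dt p (n + i)‖ ≤ ‖p‖ ^ (n ^ 2) * ‖p‖ ^ i := by
  rw [dt, norm_mul, norm_pow, norm_pow, norm_neg, norm_one, one_pow, one_mul, ← pow_add]
  exact pow_le_pow_of_le_one (norm_nonneg _) hp.le (by nlinarith [Nat.zero_le (n * i), Nat.zero_le (i * i)])

lemma dt_sum (p : ℂ) (hp : ‖p‖ < 1) (n : ℕ) : Summable fun i => dt p (n + i) :=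
  Summable.of_norm_bounded ((summable_geometric_of_lt_one (norm_nonneg _) hp).mul_left _)
    (dt_bound p hp n)

lemma dN_bound (p : ℂ) (hp : ‖p‖ < 1) (n : ℕ) : ‖dN p n‖ ≤ (1 - ‖p‖)⁻¹ * ‖p‖ ^ (n ^ 2) := by
  rw [mul_comm]
  exact tsum_of_norm_bounded ((hasSum_geometric_of_lt_one (norm_nonneg _) hp).mul_left _)
    (dt_bound p hp n)

lemma dN_rec (p : ℂ) (hp : ‖p‖ < 1) (n : ℕ) : dN p n = dt p n + dN p (n + 1) := by
  rw [dN, (dt_sum p hp n).tsum_eq_zero_add, dN]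
  simp only [add_zero]
  congr 2
  funext i
  congr 1
  ring

lemma dk_rec (p : ℂ) (hp : ‖p‖ < 1) (k : ℤ) :
    dk p k - dk p (k - 1) = (-1) ^ k * p ^ (k * (k - 1)) := by
  rcases le_or_gt k 0 with h | h
  · obtain ⟨n, rfl⟩ : ∃ n : ℕ, k = -n := ⟨k.natAbs, by omega⟩
    rw [dk, dk, show (-(n : ℤ)).natAbs = n by omega, show (-(n : ℤ) - 1).natAbs = n + 1 by omega,
      dN_rec p hp n, add_sub_cancel_right, dt, zpow_neg, ← inv_zpow, inv_neg, inv_one,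
      zpow_natCast, ← zpow_natCast p]
    congr 2
    push_cast; ring
  · obtain ⟨n, rfl⟩ : ∃ n : ℕ, k = n + 1 := ⟨(k - 1).toNat, by omega⟩
    rw [dk, dk, show ((n : ℤ) + 1).natAbs = n + 1 by omega, add_sub_cancel_right,
      Int.natAbs_natCast, dN_rec p hp n, dt, zpow_add₀ (by norm_num), zpow_natCast, zpow_one,
      ← zpow_natCast p]
    rw [show (((n * (n + 1) : ℕ)) : ℤ) = ((n : ℤ) + 1) * n by push_cast; ring]
    ring

def Jf (p y : ℂ) : ℂ := ∑' k : ℤ, dk p k * y ^ k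

lemma Jbound (p y : ℂ) (hp : ‖p‖ < 1) (R : ℝ) (h1 : ‖y‖ ≤ R) (h2 : ‖y⁻¹‖ ≤ R) (k : ℤ) :
    ‖dk p k * y ^ k‖ ≤ (1 - ‖p‖)⁻¹ * (‖p‖ ^ (k.natAbs ^ 2) * R ^ k.natAbs) := by
  rw [norm_mul, ← mul_assoc]
  have : 0 ≤ (1 - ‖p‖)⁻¹ := inv_nonneg.mpr (by linarith)
  exact mul_le_mul (dN_bound p hp _) (zb y R h1 h2 k) (norm_nonneg _) (by positivity)

lemma Jsum (p y : ℂ) (hp : ‖p‖ < 1) : Summable fun k : ℤ => dk p k * y ^ k :=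
  Summable.of_norm_bounded ((gs ‖p‖ (max ‖y‖ ‖y⁻¹‖) (norm_nonneg _) hp
    (le_max_of_le_left (norm_nonneg _))).mul_left _)
    (Jbound p y hp _ (le_max_left _ _) (le_max_right _ _))

lemma J_j (p y : ℂ) (hp : ‖p‖ < 1) (hy : y ≠ 0) : (1 - y) * Jf p y = jf p y := by
  have h := (Jsum p y hp).hasSum
  have h2 := ((Equiv.subRight (1 : ℤ)).hasSum_iff.mpr h).mul_left y
  have h3 := h.sub h2
  rw [← Jf] at h3
  have : (1 - y) * Jf p y = Jf p y - y * Jf p y := by ring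
  rw [this, ← h3.tsum_eq, jf]
  congr 1
  funext m
  rw [← dk_rec p hp]
  simp only [Function.comp, Equiv.subRight_apply]
  rw [zpow_sub₀ hy, zpow_one]
  field_simp

lemma J_tend (p : ℂ) (hp : ‖p‖ < 1) : Tendsto (Jf p) (𝓝 1) (𝓝 (Jf p 1)) := by
  refine tendsto_tsum_of_dominated_convergence
    ((gs ‖p‖ 2 (norm_nonneg _) hp (by norm_num)).mul_left ((1 - ‖p‖)⁻¹)) (fun k => ?_) ?_
  · exact tendsto_const_nhds.mul ((continuousAt_zpow₀ (1 : ℂ) k (Or.inl one_ne_zero)).tendsto)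
  · have e1 : ∀ᶠ y : ℂ in 𝓝 1, ‖y‖ < 2 :=
      (continuous_norm.tendsto (1 : ℂ)).eventually (gt_mem_nhds (by simp))
    have e2 : ∀ᶠ y : ℂ in 𝓝 1, ‖y⁻¹‖ < 2 :=
      ((continuousAt_inv₀ (one_ne_zero (α := ℂ))).norm.tendsto).eventually (gt_mem_nhds (by simp))
    filter_upwards [e1, e2] with y h1 h2 k
    exact Jbound p y hp 2 h1.le h2.le k

lemma G_tend (p z : ℂ) (hp : ‖p‖ < 1) : Tendsto (Gf p) (𝓝 z) (𝓝 (Gf p z)) := by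
  have := tendsto_tprod_one_add_of_dominated_convergence (𝓕 := 𝓝 z)
    (f := fun y (k : ℕ) => - (y * p ^ (2 * (k + 1)))) (g := fun k : ℕ => - (z * p ^ (2 * (k + 1))))
    (bound := fun k => (‖z‖ + 1) * ‖p‖ ^ (2 * (k + 1))) ((geo2 p hp).mul_left _)
    (fun k => ((tendsto_id.mul_const _).neg)) (by
      have e1 : ∀ᶠ y : ℂ in 𝓝 z, ‖y‖ < ‖z‖ + 1 :=
        (continuous_norm.tendsto z).eventually (gt_mem_nhds (by simp))
      filter_upwards [e1] with y h1 k
      rw [norm_neg, norm_mul, norm_pow]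
      gcongr)
  have e : Gf p = fun y => ∏' k : ℕ, (1 + -(y * p ^ (2 * (k + 1)))) := by
    funext y; simp only [Gf, sub_eq_add_neg]
  rw [e]
  exact this

lemma J_one (p : ℂ) (hp0 : p ≠ 0) (hp : ‖p‖ < 1) : Jf p 1 = Gf p 1 ^ 3 := by
  have t1 : Tendsto (Jf p) (𝓝[≠] 1) (𝓝 (Jf p 1)) := (J_tend p hp).mono_left nhdsWithin_le_nhds
  have t2 : Tendsto (fun y => Gf p 1 * (Gf p y * Gf p y⁻¹)) (𝓝[≠] 1)
      (𝓝 (Gf p 1 * (Gf p 1 * Gf p 1))) := by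
    refine Tendsto.mono_left ?_ nhdsWithin_le_nhds
    refine ((G_tend p 1 hp).mul ?_).const_mul _
    have hi : Tendsto (fun y : ℂ => y⁻¹) (𝓝 1) (𝓝 1) := by
      have := (continuousAt_inv₀ (one_ne_zero (α := ℂ))).tendsto
      simpa using this
    exact (G_tend p 1 hp).comp hi
  have t3 := t1.congr' (f₂ := fun y => Gf p 1 * (Gf p y * Gf p y⁻¹)) (by
    have e0 : ∀ᶠ y : ℂ in 𝓝[≠] 1, y ≠ 0 :=
      eventually_nhdsWithin_of_eventually_nhds (eventually_ne_nhds one_ne_zero)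
    filter_upwards [e0, self_mem_nhdsWithin] with y h0 h1
    have h1' : 1 - y ≠ 0 := sub_ne_zero.mpr (Ne.symm h1)
    have := J_j p y hp h0
    rw [jtp p y hp0 hp h0] at this
    apply mul_left_cancel₀ h1'
    rw [this]; ring)
  rw [tendsto_nhds_unique t3 t2]; ring

/-- double-sum terms -/
def TT (p : ℂ) (w : ℤ → ℂ) (x : ℂ) (z : ℤ × ℤ) : ℂ :=
  w z.2 * p ^ (2 * z.1 * (z.1 - 1) + 2 * z.1 * z.2) * x ^ (2 * z.1 + z.2)

lemma TT_sum (p : ℂ) (hp0 : p ≠ 0) (hp : ‖p‖ < 1) (w : ℤ → ℂ) (C R : ℝ) (hC : 0 ≤ C) (hR : 1 ≤ R)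
    (hw : ∀ k, ‖w k‖ ≤ C * (‖p‖ ^ (k.natAbs ^ 2) * R ^ k.natAbs)) (x : ℂ) (hx : x ≠ 0) :
    Summable (TT p w x) := by
  let e : ℤ × ℤ ≃ ℤ × ℤ :=
    { toFun := fun z => (z.1, z.2 - z.1)
      invFun := fun z => (z.1, z.2 + z.1)
      left_inv := fun z => by simp
      right_inv := fun z => by simp }
  rw [← e.summable_iff]
  set S := max ‖x‖ ‖x⁻¹‖ with hS
  set S' := max ‖x / p ^ 2‖ ‖(x / p ^ 2)⁻¹‖ with hS'
  have hS0 : 0 ≤ S := le_max_of_le_left (norm_nonneg _)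
  have hS0' : 0 ≤ S' := le_max_of_le_left (norm_nonneg _)
  have g1 := gs ‖p‖ (R * S') (norm_nonneg _) hp (by positivity)
  have g2 := gs ‖p‖ (R * S) (norm_nonneg _) hp (by positivity)
  have g := (g1.mul_of_nonneg g2 (fun _ => by positivity) (fun _ => by positivity)).mul_left C
  refine Summable.of_norm_bounded g ?_
  rintro ⟨n, m⟩
  simp only [Function.comp, e, Equiv.coe_fn_mk, TT]
  have hexp : p ^ (2 * n * (n - 1) + 2 * n * (m - n)) * x ^ (2 * n + (m - n)) * p ^ ((m - n) ^ 2) =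
      p ^ (n ^ 2) * (x / p ^ 2) ^ n * (p ^ (m ^ 2) * x ^ m) := by
    have h1 : (x / p ^ 2) ^ n = x ^ n * p ^ (-2 * n) := by
      rw [div_zpow, zpow_mul, div_eq_mul_inv, ← inv_zpow]; norm_cast
    rw [h1, show 2 * n + (m - n) = n + m by ring, zpow_add₀ hx]
    have : p ^ (2 * n * (n - 1) + 2 * n * (m - n)) * p ^ ((m - n) ^ 2) =
      p ^ (n ^ 2) * p ^ (-2 * n) * p ^ (m ^ 2) := by
      rw [← zpow_add₀ hp0, ← zpow_add₀ hp0, ← zpow_add₀ hp0]; congr 1; ring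
    linear_combination x ^ n * x ^ m * this
  have hR2 : R ^ (m - n).natAbs ≤ R ^ n.natAbs * R ^ m.natAbs := by
    rw [← pow_add]
    exact pow_le_pow_right₀ hR (by omega)
  calc _ ≤ C * (‖p‖ ^ ((m - n).natAbs ^ 2) * R ^ (m - n).natAbs) *
        ‖p ^ (2 * n * (n - 1) + 2 * n * (m - n))‖ * ‖x ^ (2 * n + (m - n))‖ := by
        rw [norm_mul, norm_mul]; gcongr; exact hw _
    _ = C * R ^ (m - n).natAbs * ‖p ^ (2 * n * (n - 1) + 2 * n * (m - n)) * x ^ (2 * n + (m - n)) *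
          p ^ ((m - n) ^ 2)‖ := by
        rw [norm_mul, norm_mul, zsq]; ring
    _ = C * R ^ (m - n).natAbs * (‖p‖ ^ (n.natAbs ^ 2) * ‖(x / p ^ 2) ^ n‖ *
          (‖p‖ ^ (m.natAbs ^ 2) * ‖x ^ m‖)) := by
        rw [hexp, norm_mul, norm_mul, norm_mul, zsq, zsq]
    _ ≤ C * (R ^ n.natAbs * R ^ m.natAbs) * (‖p‖ ^ (n.natAbs ^ 2) * S' ^ n.natAbs *
          (‖p‖ ^ (m.natAbs ^ 2) * S ^ m.natAbs)) := by
        gcongr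
        · exact zb _ _ (le_max_left _ _) (le_max_right _ _) n
        · exact zb _ _ (le_max_left _ _) (le_max_right _ _) m
    _ = _ := by rw [mul_pow, mul_pow]; ring

lemma even_odd_int (f : ℤ → ℂ) (a b : ℂ) (he : HasSum (fun l : ℤ => f (2 * l)) a)
    (ho : HasSum (fun l : ℤ => f (2 * l + 1)) b) : HasSum f (a + b) := by
  have h2 := mul_right_injective₀ (two_ne_zero' ℤ)
  replace ho := ((add_left_injective (1 : ℤ)).comp h2).hasSum_range_iff.2 ho
  refine (h2.hasSum_range_iff.2 he).add_isCompl ?_ ho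
  simpa [Function.comp_def] using Int.isCompl_even_odd

def E0 (p x : ℂ) : ℂ := ∑' n : ℤ, p ^ (2 * n * (n - 1)) * x ^ (2 * n)
def E1 (p x : ℂ) : ℂ := ∑' n : ℤ, p ^ (2 * n ^ 2) * x ^ (2 * n + 1)

lemma spanTT (p : ℂ) (hp0 : p ≠ 0) (w : ℤ → ℂ) (x : ℂ) (hs : Summable (TT p w x)) :
    ∑' z, TT p w x z = (∑' l : ℤ, w (2 * l) * p ^ (2 * (l - l ^ 2))) * E0 p x +
      (∑' l : ℤ, w (2 * l + 1) * p ^ (-2 * l ^ 2)) * E1 p x := by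
  have hs' : Summable fun z : ℤ × ℤ => TT p w x (z.2, z.1) := (Equiv.prodComm ℤ ℤ).summable_iff.mpr hs
  have h1 : ∑' z, TT p w x z = ∑' k : ℤ, ∑' n : ℤ, TT p w x (n, k) := by
    rw [← (Equiv.prodComm ℤ ℤ).tsum_eq]
    exact hs'.tsum_prod
  have hk : Summable fun k : ℤ => ∑' n : ℤ, TT p w x (n, k) := hs'.prod
  have he : ∀ l : ℤ, ∑' n : ℤ, TT p w x (n, 2 * l) = w (2 * l) * p ^ (2 * (l - l ^ 2)) * E0 p x := by
    intro l
    rw [E0, ← tsum_mul_left, ← (Equiv.subRight l).tsum_eq]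
    congr 1; funext n
    simp only [TT, Equiv.subRight_apply]
    have : p ^ (2 * (n - l) * (n - l - 1) + 2 * (n - l) * (2 * l)) =
        p ^ (2 * (l - l ^ 2)) * p ^ (2 * n * (n - 1)) := by
      rw [← zpow_add₀ hp0]; congr 1; ring
    rw [this, show 2 * (n - l) + 2 * l = 2 * n by ring]
    ring
  have ho : ∀ l : ℤ, ∑' n : ℤ, TT p w x (n, 2 * l + 1) =
      w (2 * l + 1) * p ^ (-2 * l ^ 2) * E1 p x := by
    intro l
    rw [E1, ← tsum_mul_left, ← (Equiv.subRight l).tsum_eq]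
    congr 1; funext n
    simp only [TT, Equiv.subRight_apply]
    have : p ^ (2 * (n - l) * (n - l - 1) + 2 * (n - l) * (2 * l + 1)) =
        p ^ (-2 * l ^ 2) * p ^ (2 * n ^ 2) := by
      rw [← zpow_add₀ hp0]; congr 1; ring
    rw [this, show 2 * (n - l) + (2 * l + 1) = 2 * n + 1 by ring]
    ring
  have se : Summable fun l : ℤ => ∑' n : ℤ, TT p w x (n, 2 * l) :=
    hk.comp_injective (i := fun l : ℤ => 2 * l) (fun a b h => by simpa using h)
  have so : Summable fun l : ℤ => ∑' n : ℤ, TT p w x (n, 2 * l + 1) :=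
    hk.comp_injective (i := fun l : ℤ => 2 * l + 1) (fun a b h => by simpa using h)
  have := (even_odd_int (fun k : ℤ => ∑' n : ℤ, TT p w x (n, k)) _ _ se.hasSum so.hasSum).tsum_eq
  rw [h1, this]
  rw [tsum_congr he, tsum_congr ho, tsum_mul_right, tsum_mul_right]

lemma f_span (p a : ℂ) (hp0 : p ≠ 0) (hp : ‖p‖ < 1) (ha : a ≠ 0) :
    ∃ c0 c1 : ℂ, ∀ x, x ≠ 0 → jf p (a * x) * jf p (x / a) = c0 * E0 p x + c1 * E1 p x := by
  let w : ℤ → ℂ := fun k => (-1) ^ k * p ^ (k * (k - 1)) * a ^ k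
  let e : ℤ × ℤ ≃ ℤ × ℤ :=
    { toFun := fun z => (z.1 + z.2, z.1)
      invFun := fun z => (z.2, z.1 - z.2)
      left_inv := fun z => by simp
      right_inv := fun z => by simp }
  refine ⟨∑' l : ℤ, w (2 * l) * p ^ (2 * (l - l ^ 2)),
    ∑' l : ℤ, w (2 * l + 1) * p ^ (-2 * l ^ 2), fun x hx => ?_⟩
  · have hTT : TT p w x = (fun z : ℤ × ℤ => ((-1) ^ z.1 * p ^ (z.1 * (z.1 - 1)) * (a * x) ^ z.1) *
        ((-1) ^ z.2 * p ^ (z.2 * (z.2 - 1)) * (x / a) ^ z.2)) ∘ e := by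
      funext ⟨n, k⟩
      simp only [TT, w, e, Function.comp, Equiv.coe_fn_mk]
      rw [zpow_add₀ (by norm_num : (-1 : ℂ) ≠ 0), zpow_add₀ (mul_ne_zero ha hx), div_zpow,
        mul_zpow, mul_zpow, zpow_add₀ hx, two_mul n, zpow_add₀ hx]
      have h1 : ((-1 : ℂ)) ^ n * (-1) ^ n = 1 := by rw [← mul_zpow]; simp
      have h2 : p ^ ((n + k) * (n + k - 1)) * p ^ (n * (n - 1)) =
          p ^ (k * (k - 1)) * p ^ ((n + n) * (n - 1) + (n + n) * k) := by
        rw [← zpow_add₀ hp0, ← zpow_add₀ hp0]; congr 1; ring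
      have h3 : a ^ n ≠ 0 := zpow_ne_zero _ ha
      calc _ = (-1) ^ k * (p ^ (k * (k - 1)) * p ^ ((n + n) * (n - 1) + (n + n) * k)) * a ^ k *
            (x ^ n * x ^ n * x ^ k) := by ring
        _ = ((-1 : ℂ) ^ n * (-1) ^ n) * (-1) ^ k * (p ^ ((n + k) * (n + k - 1)) * p ^ (n * (n - 1))) *
            a ^ k * (x ^ n * x ^ n * x ^ k) := by rw [h1, h2]; ring
        _ = _ := by field_simp
    have s0 := summable_mul_of_summable_norm (jsum p (a * x) hp0 hp) (jsum p (x / a) hp0 hp)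
    have hs : Summable (TT p w x) := by rw [hTT]; exact e.summable_iff.mpr s0
    have := spanTT p hp0 w x hs
    rw [← this, jf, jf, tsum_mul_tsum_of_summable_norm (jsum p (a * x) hp0 hp)
      (jsum p (x / a) hp0 hp), hTT]
    exact (e.tsum_eq _).symm

def Bf (p a x : ℂ) : ℂ := ∑' n : ℤ, p ^ (2 * n * (n - 1)) * x ^ (2 * n) * Jf p (a * x * p ^ (2 * n))

lemma B_span (p a : ℂ) (hp0 : p ≠ 0) (hp : ‖p‖ < 1) (ha : a ≠ 0) :
    ∃ c0 c1 : ℂ, ∀ x, x ≠ 0 → Bf p a x = c0 * E0 p x + c1 * E1 p x := by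
  let w : ℤ → ℂ := fun k => dk p k * a ^ k
  refine ⟨∑' l : ℤ, w (2 * l) * p ^ (2 * (l - l ^ 2)),
    ∑' l : ℤ, w (2 * l + 1) * p ^ (-2 * l ^ 2), fun x hx => ?_⟩
  · have hs : Summable (TT p w x) := by
      refine TT_sum p hp0 hp w (1 - ‖p‖)⁻¹ (max 1 (max ‖a‖ ‖a⁻¹‖)) (inv_nonneg.mpr (by linarith))
        (le_max_left _ _) (fun k => Jbound p a hp _ ?_ ?_ k) x hx
      · exact (le_max_left _ _).trans (le_max_right _ _)
      · exact (le_max_right _ _).trans (le_max_right _ _)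
    rw [← spanTT p hp0 w x hs, hs.tsum_prod, Bf]
    congr 1; funext n
    rw [Jf, ← tsum_mul_left]
    congr 1; funext k
    simp only [TT, w]
    rw [zpow_add₀ hp0, zpow_add₀ hx, mul_zpow, mul_zpow, ← zpow_mul]
    ring

lemma j_shift (p y : ℂ) (hp0 : p ≠ 0) (hy : y ≠ 0) (n : ℤ) :
    jf p (y * p ^ (2 * n)) = (-1) ^ n * p ^ (-(n * (n - 1))) * y ^ (-n) * jf p y := by
  rw [jf, jf, ← tsum_mul_left]
  conv_rhs => rw [← (Equiv.addRight n).tsum_eq]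
  congr 1; funext m
  simp only [Equiv.coe_addRight]
  rw [mul_zpow, ← zpow_mul, zpow_add₀ hy, zpow_add₀ (by norm_num : (-1 : ℂ) ≠ 0), zpow_neg y]
  have h1 : ((-1 : ℂ)) ^ n * (-1) ^ n = 1 := by rw [← mul_zpow]; simp
  have h2 : p ^ (m * (m - 1)) * p ^ (2 * n * m) = p ^ (-(n * (n - 1))) * p ^ ((m + n) * (m + n - 1)) := by
    rw [← zpow_add₀ hp0, ← zpow_add₀ hp0]; congr 1; ring
  have h3 : y ^ n ≠ 0 := zpow_ne_zero _ hy
  calc _ = (-1) ^ m * (p ^ (m * (m - 1)) * p ^ (2 * n * m)) * y ^ m := by ring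
    _ = ((-1 : ℂ) ^ n * (-1) ^ n) * (-1) ^ m * (p ^ (-(n * (n - 1))) * p ^ ((m + n) * (m + n - 1))) * y ^ m := by
      rw [h1, h2]; ring
    _ = _ := by field_simp

lemma j_one (p : ℂ) (hp : ‖p‖ < 1) : jf p 1 = 0 := by
  rw [← J_j p 1 hp one_ne_zero]; simp

lemma B_eval (p a x : ℂ) (hp0 : p ≠ 0) (hp : ‖p‖ < 1) (ha : a ≠ 0) (hx : x ≠ 0)
    (h : ∀ n : ℤ, a * x * p ^ (2 * n) ≠ 1) :
    Bf p a x = jf p (a * x) *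
      ∑' n : ℤ, (-1) ^ n * p ^ (n * (n - 1)) * (x / a) ^ n / (1 - a * x * p ^ (2 * n)) := by
  rw [Bf, ← tsum_mul_left]
  congr 1; funext n
  have hax := mul_ne_zero ha hx
  have h1 : 1 - a * x * p ^ (2 * n) ≠ 0 := sub_ne_zero.mpr (h n).symm
  have h2 := J_j p (a * x * p ^ (2 * n)) hp (mul_ne_zero hax (zpow_ne_zero _ hp0))
  rw [j_shift p (a * x) hp0 hax] at h2
  have h3 : Jf p (a * x * p ^ (2 * n)) =
      (-1) ^ n * p ^ (-(n * (n - 1))) * (a * x) ^ (-n) * jf p (a * x) / (1 - a * x * p ^ (2 * n)) := by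
    rw [eq_div_iff h1, mul_comm, h2]
  rw [h3, div_zpow, zpow_neg, zpow_neg, mul_zpow, two_mul n, zpow_add₀ hx,
    show (n + n) * (n - 1) = n * (n - 1) + n * (n - 1) by ring, zpow_add₀ hp0]
  have := zpow_ne_zero n ha
  have := zpow_ne_zero n hx
  have := zpow_ne_zero (n * (n - 1)) hp0
  field_simp

lemma zpow_ne_one (p : ℂ) (hp0 : p ≠ 0) (hp : ‖p‖ < 1) (n : ℤ) (hn : n ≠ 0) : ‖p ^ n‖ ≠ 1 := by
  rw [norm_zpow]
  have hp' : 0 < ‖p‖ := norm_pos_iff.mpr hp0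
  rcases lt_or_gt_of_ne hn with h | h
  · exact (one_lt_zpow_of_neg₀ hp' hp h).ne'
  · exact (zpow_lt_one₀ hp' hp h).ne

lemma B_special (p : ℂ) (hp0 : p ≠ 0) (hp : ‖p‖ < 1) : Bf p p⁻¹ p = Jf p 1 := by
  rw [Bf, tsum_eq_single 0]
  · simp [hp0]
  · intro n hn
    have h1 : (1 : ℂ) - p ^ (2 * n) ≠ 0 := by
      intro h
      apply zpow_ne_one p hp0 hp (2 * n) (by omega)
      rw [← sub_eq_zero.mp h]; simp
    have h2 := J_j p (p ^ (2 * n)) hp (zpow_ne_zero _ hp0)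
    have h3 := j_shift p 1 hp0 one_ne_zero n
    rw [j_one p hp, mul_zero, one_mul] at h3
    rw [h3] at h2
    rw [inv_mul_cancel₀ hp0, one_mul, (mul_eq_zero.mp h2).resolve_left h1, mul_zero]

lemma G_step (p y : ℂ) (hp : ‖p‖ < 1) : Gf p y = (1 - y * p ^ 2) * Gf p (y * p ^ 2) := by
  have := (Gtend p y hp)
  rw [← tendsto_add_atTop_iff_nat 1] at this
  simp_rw [Finset.prod_range_succ'] at this
  refine tendsto_nhds_unique this ?_
  have h2 := (Gtend p (y * p ^ 2) hp).const_mul (1 - y * p ^ 2)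
  refine h2.congr fun N => ?_
  rw [mul_comm]
  congr 1
  · exact Finset.prod_congr rfl fun k _ => by ring

lemma O_step (p e : ℂ) (hp0 : p ≠ 0) (hp : ‖p‖ < 1) :
    Gf p (e * p⁻¹) = (1 - e * p) * Gf p (e * p) := by
  rw [G_step p _ hp, show e * p⁻¹ * p ^ 2 = e * p by field_simp]

lemma euler (p : ℂ) (hp0 : p ≠ 0) (hp : ‖p‖ < 1) :
    Gf p (-1) * (Gf p (1 * p⁻¹) * Gf p (-1 * p⁻¹)) = 1 := by
  have ho := (Gmul p (1 * p⁻¹) hp).hasProd.mul (Gmul p (-1 * p⁻¹) hp).hasProd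
  have he := (Gmul p 1 hp).hasProd.mul (Gmul p (-1) hp).hasProd
  have h := (Gmul p 1 hp).hasProd.tprod_eq
  have h2 : HasProd (fun k : ℕ => 1 - 1 * p ^ (2 * (k + 1)))
      (Gf p (1 * p⁻¹) * Gf p (-1 * p⁻¹) * (Gf p 1 * Gf p (-1))) := by
    refine HasProd.even_mul_odd (f := fun k : ℕ => 1 - 1 * p ^ (2 * (k + 1))) ?_ ?_
    · convert ho using 2 with k
      · have e1 : p⁻¹ * p ^ (2 * (k + 1)) = p ^ (2 * k + 1) := by
          rw [show 2 * (k + 1) = 2 * k + 1 + 1 by ring, pow_succ _ (2 * k + 1)]; field_simp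
        rw [one_mul, one_mul, neg_one_mul, neg_mul, e1]
        ring
      · rfl
      · rfl
    · convert he using 2 with k
      · ring
      · rfl
      · rfl
  have h3 : Gf p 1 = _ := h2.tprod_eq
  have hG := G1_ne p hp
  apply mul_left_cancel₀ hG
  rw [mul_one]
  conv_rhs => rw [h3]
  ring

lemma j_prod (p : ℂ) (hp0 : p ≠ 0) (hp : ‖p‖ < 1) :
    jf p (-1) * jf p (-p) * jf p p = 2 * Gf p 1 ^ 3 := by
  rw [jtp p _ hp0 hp (by norm_num), jtp p _ hp0 hp (neg_ne_zero.mpr hp0), jtp p _ hp0 hp hp0]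
  have e := euler p hp0 hp
  have o1 := O_step p 1 hp0 hp
  have o2 := O_step p (-1) hp0 hp
  rw [inv_neg, inv_neg, inv_one]
  simp only [one_mul, neg_one_mul] at e o1 o2
  calc _ = 2 * Gf p 1 ^ 3 * (Gf p (-1) ^ 2 * (((1 - p) * Gf p p) * Gf p p⁻¹) *
        (((1 - -p) * Gf p (-p)) * Gf p (-p⁻¹))) := by ring
    _ = 2 * Gf p 1 ^ 3 * (Gf p (-1) * (Gf p p⁻¹ * Gf p (-p⁻¹))) ^ 2 := by
      rw [← o1, ← o2]; ring
    _ = _ := by rw [e]; ring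

lemma j_refl (p y : ℂ) (hp0 : p ≠ 0) (hp : ‖p‖ < 1) (hy : y ≠ 0) :
    jf p y⁻¹ = - y⁻¹ * jf p y := by
  rw [jtp p _ hp0 hp hy, jtp p _ hp0 hp (inv_ne_zero hy), inv_inv]
  field_simp
  ring

lemma mainid (p : ℂ) (hp0 : p ≠ 0) (hp : ‖p‖ < 1) :
    jf p (-p) * jf p p * (jf p p * (∑' n : ℤ, p ^ (n ^ 2) / (1 + p ^ (2 * n - 1))) -
      jf p (-p) * ∑' n : ℤ, (-1) ^ n * p ^ (n ^ 2) / (1 - p ^ (2 * n - 1))) =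
      p * jf p (-1) ^ 2 * Gf p 1 ^ 3 := by
  have hi := inv_ne_zero hp0
  have r1 := j_refl p p hp0 hp hp0
  have r2 := j_refl p (-p) hp0 hp (neg_ne_zero.mpr hp0)
  rw [inv_neg, neg_neg] at r2
  have hP := j_prod p hp0 hp
  have hG := pow_ne_zero 3 (G1_ne p hp)
  have hT4 : jf p p ≠ 0 := by
    intro h; rw [h, mul_zero] at hP; exact mul_ne_zero two_ne_zero hG hP.symm
  have hpn : ∀ n : ℤ, p⁻¹ * p ^ (2 * n) = p ^ (2 * n - 1) := fun n => by
    rw [zpow_sub₀ hp0, zpow_one]; field_simp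
  have hpp : ∀ n : ℤ, p ^ (n * (n - 1)) * p ^ n = p ^ (n ^ 2) := fun n => by
    rw [← zpow_add₀ hp0]; congr 1; ring
  have b1 := B_eval p p⁻¹ 1 hp0 hp hi one_ne_zero (fun n h => by
    rw [mul_one, hpn] at h
    exact zpow_ne_one p hp0 hp (2 * n - 1) (by omega) (by rw [h]; simp))
  have b2 := B_eval p p⁻¹ (-1) hp0 hp hi (by norm_num) (fun n h => by
    rw [mul_neg, mul_one, neg_mul, hpn] at h
    exact zpow_ne_one p hp0 hp (2 * n - 1) (by omega) (by rw [← norm_neg, h]; simp))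
  have s1 : ∀ n : ℤ, (-1) ^ n * p ^ (n * (n - 1)) * (1 / p⁻¹) ^ n / (1 - p⁻¹ * 1 * p ^ (2 * n)) =
      (-1) ^ n * p ^ (n ^ 2) / (1 - p ^ (2 * n - 1)) := fun n => by
    rw [mul_one, hpn, one_div, inv_inv, mul_assoc, hpp]
  have s2 : ∀ n : ℤ, (-1) ^ n * p ^ (n * (n - 1)) * (-1 / p⁻¹) ^ n / (1 - p⁻¹ * -1 * p ^ (2 * n)) =
      p ^ (n ^ 2) / (1 + p ^ (2 * n - 1)) := fun n => by
    have h1 : ((-1 : ℂ)) ^ n * (-1) ^ n = 1 := by rw [← mul_zpow]; simp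
    rw [mul_neg, mul_one, neg_mul, hpn, div_inv_eq_mul, mul_zpow, sub_neg_eq_add, ← hpp]
    congr 1
    linear_combination p ^ (n * (n - 1)) * p ^ n * h1
  rw [tsum_congr s1, mul_one, r1] at b1
  rw [tsum_congr s2, mul_neg, mul_one, r2] at b2
  have b3 := B_special p hp0 hp
  rw [J_one p hp0 hp] at b3
  obtain ⟨c0, c1, hB⟩ := B_span p p⁻¹ hp0 hp hi
  obtain ⟨d0, d1, hd⟩ := f_span p 1 hp0 hp one_ne_zero
  obtain ⟨f0, f1, hf⟩ := f_span p p⁻¹ hp0 hp hi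
  have n1 : (-1 : ℂ) ≠ 0 := by norm_num
  have B1 := hB 1 one_ne_zero
  have B2 := hB (-1) n1
  have B3 := hB p hp0
  have D1 := hd 1 one_ne_zero
  have D2 := hd (-1) n1
  have D3 := hd p hp0
  have F1 := hf 1 one_ne_zero
  have F2 := hf (-1) n1
  have F3 := hf p hp0
  rw [b1] at B1
  rw [b2] at B2
  rw [b3] at B3
  simp only [one_mul, div_one, mul_one, mul_neg, div_inv_eq_mul, inv_mul_cancel₀ hp0, neg_one_mul,
    j_one p hp, zero_mul, r1, r2] at D1 D2 D3 F1 F2 F3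
  generalize (∑' n : ℤ, p ^ (n ^ 2) / (1 + p ^ (2 * n - 1))) = A3 at *
  generalize (∑' n : ℤ, (-1) ^ n * p ^ (n ^ 2) / (1 - p ^ (2 * n - 1))) = A4 at *
  have det : ∀ x1 y1 x2 y2 x3 y3 : ℂ,
      (d0 * x1 + d1 * y1) * ((f0 * x2 + f1 * y2) * (c0 * x3 + c1 * y3) - (f0 * x3 + f1 * y3) * (c0 * x2 + c1 * y2))
      - (d0 * x2 + d1 * y2) * ((f0 * x1 + f1 * y1) * (c0 * x3 + c1 * y3) - (f0 * x3 + f1 * y3) * (c0 * x1 + c1 * y1))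
      + (d0 * x3 + d1 * y3) * ((f0 * x1 + f1 * y1) * (c0 * x2 + c1 * y2) - (f0 * x2 + f1 * y2) * (c0 * x1 + c1 * y1))
      = 0 := by intros; ring
  have key := det (E0 p 1) (E1 p 1) (E0 p (-1)) (E1 p (-1)) (E0 p p) (E1 p p)
  rw [← B1, ← B2, ← B3, ← D1, ← D2, ← D3, ← F1, ← F2, ← F3] at key
  apply mul_left_cancel₀ (pow_ne_zero 2 hT4)
  field_simp at key
  linear_combination -key

lemma quartic (p : ℂ) (hp0 : p ≠ 0) (hp : ‖p‖ < 1) :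
    p * jf p (-1) ^ 4 = jf p (-p) ^ 4 - jf p p ^ 4 := by
  have hi := inv_ne_zero hp0
  have r1 := j_refl p p hp0 hp hp0
  have hP := j_prod p hp0 hp
  have hG := pow_ne_zero 3 (G1_ne p hp)
  have hT4 : jf p p ≠ 0 := by
    intro h; rw [h, mul_zero] at hP; exact mul_ne_zero two_ne_zero hG hP.symm
  have r3 : jf p (-(p * p)) = jf p (-1) := by
    have := j_shift p (-1) hp0 (by norm_num) 1
    rw [show (-1 : ℂ) * p ^ (2 * (1 : ℤ)) = -(p * p) by
      rw [mul_one, show (2 : ℤ) = (2 : ℕ) by rfl, zpow_natCast]; ring] at this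
    rw [this]; norm_num
  have n1 : (-1 : ℂ) ≠ 0 := by norm_num
  obtain ⟨c0, c1, hB⟩ := f_span p (-1) hp0 hp n1
  obtain ⟨d0, d1, hd⟩ := f_span p 1 hp0 hp one_ne_zero
  obtain ⟨f0, f1, hf⟩ := f_span p p⁻¹ hp0 hp hi
  have B1 := hB 1 one_ne_zero
  have B2 := hB (-p) (neg_ne_zero.mpr hp0)
  have B3 := hB p hp0
  have D1 := hd 1 one_ne_zero
  have D2 := hd (-p) (neg_ne_zero.mpr hp0)
  have D3 := hd p hp0
  have F1 := hf 1 one_ne_zero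
  have F2 := hf (-p) (neg_ne_zero.mpr hp0)
  have F3 := hf p hp0
  simp only [one_mul, div_one, mul_one, mul_neg, div_inv_eq_mul, inv_mul_cancel₀ hp0, neg_mul,
    j_one p hp, zero_mul, r1, r3, div_neg, neg_neg] at B1 B2 B3 D1 D2 D3 F1 F2 F3
  have det : ∀ x1 y1 x2 y2 x3 y3 : ℂ,
      (d0 * x1 + d1 * y1) * ((f0 * x2 + f1 * y2) * (c0 * x3 + c1 * y3) - (f0 * x3 + f1 * y3) * (c0 * x2 + c1 * y2))
      - (d0 * x2 + d1 * y2) * ((f0 * x1 + f1 * y1) * (c0 * x3 + c1 * y3) - (f0 * x3 + f1 * y3) * (c0 * x1 + c1 * y1))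
      + (d0 * x3 + d1 * y3) * ((f0 * x1 + f1 * y1) * (c0 * x2 + c1 * y2) - (f0 * x2 + f1 * y2) * (c0 * x1 + c1 * y1))
      = 0 := by intros; ring
  have key := det (E0 p 1) (E1 p 1) (E0 p (-p)) (E1 p (-p)) (E0 p p) (E1 p p)
  rw [← B1, ← B2, ← B3, ← D1, ← D2, ← D3, ← F1, ← F2, ← F3] at key
  apply mul_left_cancel₀ (pow_ne_zero 2 hT4)
  field_simp at key
  linear_combination -key

lemma qp_int (τ : ℂ) (n : ℤ) (s : ℂ) (hs : s = n / 2) :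
    qp τ s = Complex.exp ((Real.pi : ℂ) * Complex.I * τ) ^ n := by
  rw [qp, ← Complex.exp_int_mul, hs]; congr 1; ring

lemma qp_sub (τ : ℂ) (s t : ℂ) : qp τ (s - t) = qp τ s * (qp τ t)⁻¹ := by
  rw [qp, qp, qp, ← Complex.exp_neg, ← Complex.exp_add]; congr 1; ring

lemma qp_add (τ : ℂ) (s t : ℂ) : qp τ (s + t) = qp τ s * qp τ t := by
  rw [qp, qp, qp, ← Complex.exp_add]; congr 1; ring

/-- Alternative representation of `F`:
`F(τ) = θ₂(τ)⁴/(4η(τ)³) − (1/θ₃(τ)) ∑_{n∈ℤ} q^{n²/2−1/8}/(1 + q^{n−1/2})`,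
equivalently `24 F(τ) = H(τ) + 2(θ₂(τ)⁴ + θ₃(τ)⁴)/η(τ)³`. -/
theorem F_alternative_representation (τ : ℂ) (hτ : 0 < τ.im) :
    F0 τ = theta2 τ ^ 4 / (4 * etaDedekind τ ^ 3) -
      (1 / theta3 τ) *
        ∑' n : ℤ, qp τ ((n : ℂ) ^ 2 / 2 - 1 / 8) / (1 + qp τ ((n : ℂ) - 1 / 2)) ∧
    24 * F0 τ = H0 τ + 2 * (theta2 τ ^ 4 + theta3 τ ^ 4) / etaDedekind τ ^ 3 := by
  set p := Complex.exp ((Real.pi : ℂ) * Complex.I * τ) with hpdef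
  set c := qp τ (1 / 8) with hc
  have hp0 : p ≠ 0 := Complex.exp_ne_zero _
  have hp : ‖p‖ < 1 := by
    rw [hpdef, Complex.norm_exp, Real.exp_lt_one_iff]
    have : ((Real.pi : ℂ) * Complex.I * τ).re = -(Real.pi * τ.im) := by simp
    rw [this]
    have := mul_pos Real.pi_pos hτ
    linarith
  have hc0 : c ≠ 0 := Complex.exp_ne_zero _
  have hc4 : c ^ 4 = p := by
    rw [hc, qp, ← Complex.exp_nat_mul, hpdef]; congr 1; push_cast; ring
  have hsq : ∀ n : ℤ, qp τ ((n : ℂ) ^ 2 / 2) = p ^ (n ^ 2) := fun n =>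
    qp_int τ (n ^ 2) _ (by push_cast; ring)
  have hlin : ∀ n : ℤ, qp τ ((n : ℂ) - 1 / 2) = p ^ (2 * n - 1) := fun n =>
    qp_int τ (2 * n - 1) _ (by push_cast; ring)
  have hpp : ∀ n : ℤ, p ^ (n * (n - 1)) * p ^ n = p ^ (n ^ 2) := fun n => by
    rw [← zpow_add₀ hp0]; congr 1; ring
  have hone : ∀ n : ℤ, ((-1 : ℂ)) ^ n * (-1) ^ n = 1 := fun n => by rw [← mul_zpow]; simp
  have t4 : theta4 τ = jf p p := by
    rw [theta4, jf]; congr 1; funext n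
    rw [hsq, mul_assoc, hpp]
  have t3 : theta3 τ = jf p (-p) := by
    rw [theta3, jf]; congr 1; funext n
    have hneg : (-p) ^ n = (-1) ^ n * p ^ n := by rw [neg_eq_neg_one_mul p, mul_zpow]
    rw [hsq, hneg, ← hpp]
    linear_combination (-(p ^ (n * (n - 1)) * p ^ n)) * hone n
  have t2 : theta2 τ = c * jf p (-1) := by
    rw [theta2, jf, ← tsum_mul_left, ← (Equiv.subRight (1 : ℤ)).tsum_eq]; congr 1; funext n
    simp only [Equiv.subRight_apply]
    rw [show (((n - 1 : ℤ) : ℂ) + 1 / 2) ^ 2 / 2 = ((n : ℂ) * (n - 1)) / 2 + 1 / 8 by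
      push_cast; ring, qp_add, qp_int τ (n * (n - 1)) _ (by push_cast; ring), ← hc, ← hpdef]
    linear_combination (-(p ^ (n * (n - 1)) * c)) * hone n
  have e3 : etaDedekind τ ^ 3 = c * Gf p 1 ^ 3 := by
    rw [etaDedekind, mul_pow, ← Complex.exp_nat_mul, Gf]
    congr 1
    · rw [hc, qp]; congr 1; push_cast; ring
    · congr 2; funext n
      rw [qp_int τ ((2 * (n + 1) : ℕ) : ℤ) _ (by push_cast; ring), zpow_natCast, one_mul]
  have S3 : ∑' n : ℤ, qp τ ((n : ℂ) ^ 2 / 2 - 1 / 8) / (1 + qp τ ((n : ℂ) - 1 / 2)) =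
      c⁻¹ * ∑' n : ℤ, p ^ (n ^ 2) / (1 + p ^ (2 * n - 1)) := by
    rw [← tsum_mul_left]; congr 1; funext n
    rw [qp_sub, hsq, hlin, ← hc]; ring
  have S4 : ∑' n : ℤ, (-1 : ℂ) ^ n * qp τ ((n : ℂ) ^ 2 / 2 - 1 / 8) / (1 - qp τ ((n : ℂ) - 1 / 2)) =
      c⁻¹ * ∑' n : ℤ, (-1) ^ n * p ^ (n ^ 2) / (1 - p ^ (2 * n - 1)) := by
    rw [← tsum_mul_left]; congr 1; funext n
    rw [qp_sub, hsq, hlin, ← hc]; ring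
  have hP := j_prod p hp0 hp
  have hG := G1_ne p hp
  have hM := mainid p hp0 hp
  have hQ := quartic p hp0 hp
  have hne : jf p (-1) * jf p (-p) * jf p p ≠ 0 := by
    rw [hP]; exact mul_ne_zero two_ne_zero (pow_ne_zero 3 hG)
  have h4 : jf p p ≠ 0 := right_ne_zero_of_mul hne
  have h3 : jf p (-p) ≠ 0 := right_ne_zero_of_mul (left_ne_zero_of_mul hne)
  have h2 : jf p (-1) ≠ 0 := left_ne_zero_of_mul (left_ne_zero_of_mul hne)
  rw [H0, F0, S3, S4, t2, t3, t4, e3]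
  generalize (∑' n : ℤ, p ^ (n ^ 2) / (1 + p ^ (2 * n - 1))) = A3 at *
  generalize (∑' n : ℤ, (-1) ^ n * p ^ (n ^ 2) / (1 - p ^ (2 * n - 1))) = A4 at *
  generalize jf p (-1) = T2 at *
  generalize jf p (-p) = T3 at *
  generalize jf p p = T4 at *
  have hg : Gf p 1 ^ 3 = T2 * T3 * T4 / 2 := by rw [hP]; ring
  rw [hg] at hM ⊢
  have hM' : T4 * A3 - T3 * A4 = p * T2 ^ 3 / 2 := by
    apply mul_left_cancel₀ (mul_ne_zero h3 h4)
    rw [hM]; ring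
  have key : -(1 / T4) * (c⁻¹ * A4) = (c * T2) ^ 4 / (4 * (c * (T2 * T3 * T4 / 2))) -
      1 / T3 * (c⁻¹ * A3) := by
    rw [← hc4] at hM'
    field_simp
    linear_combination 4 * hM'
  refine ⟨key, ?_⟩
  rw [key]
  rw [← hc4] at hQ
  field_simp
  linear_combination 16 * hQ
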